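/- Let k be an even integer ≥ 4, let M := ⌊k/6⌋, and for an integer m ≥ 1 set t_m := (1/2)·cot(mπ/(k+1)). (a) For every integer m with 1 ≤ m ≤ M−1, the numbers i·E_k'(1/2 + i·t_m) and i·E_k'(1/2 + i·t_{m+1}) are nonzero real numbers with opposite signs. (b) If k ≡ 4 (mod 6) and k ≠ 4, then i·E_k'(1/2 + i·√3/2) and i·E_k'(1/2 + i·t_M) are nonzero real numbers with opposite signs. -/

import Mathlib

/-- The normalized Eisenstein series of even weight `k ≥ 4` (the definition also
makes sense for `k = 2`, giving the quasi-modular Eisenstein series `E₂`), defined by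
its Fourier expansion `E_k(z) = 1 - (2k/B_k) ∑_{n≥1} σ_{k-1}(n) qⁿ`, `q = exp(2πiz)`. -/
noncomputable def Ek (k : ℕ) (z : ℂ) : ℂ :=
  1 - (2 * (k : ℂ) / ((bernoulli k : ℚ) : ℂ)) *
    ∑' n : ℕ, (∑ d ∈ n.divisors, (d : ℂ) ^ (k - 1)) * Complex.exp (2 * Real.pi * Complex.I * z) ^ n

/-- The series `∑ n σ_{k-1}(n) xⁿ`, obtained from the non-constant part of the `q`-expansion of the
Eisenstein series of weight `k` by applying `q d/dq`. -/
noncomputable def thetaSigma (k : ℕ) (x : ℝ) : ℝ :=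
  ∑' n : ℕ, (n : ℝ) * (∑ d ∈ n.divisors, (d : ℝ) ^ (k - 1)) * x ^ n

lemma sum_divisors_pow_le {k : ℕ} (hk : 1 ≤ k) (n : ℕ) :
    ∑ d ∈ n.divisors, (d : ℝ) ^ (k - 1) ≤ (n : ℝ) ^ k := by
  have h := ArithmeticFunction.sigma_le_pow_succ (k - 1) n
  rw [ArithmeticFunction.sigma_apply, Nat.sub_add_cancel hk] at h
  exact_mod_cast h

lemma hasDerivAt_tsum_mul_pow {k : ℕ} {a : ℕ → ℂ} (ha : ∀ n, ‖a n‖ ≤ (n : ℝ) ^ k) {q : ℂ}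
    (hq : ‖q‖ < 1) :
    HasDerivAt (fun w : ℂ => ∑' n : ℕ, a n * w ^ n) (∑' n : ℕ, a n * (n * q ^ (n - 1))) q := by
  obtain ⟨ρ, hρ1, hρ2⟩ := exists_between hq
  have hρ0 : 0 < ρ := (norm_nonneg q).trans_lt hρ1
  have hρn : ‖ρ‖ < 1 := by rwa [Real.norm_of_nonneg hρ0.le]
  have hs : Summable fun n : ℕ => (n : ℝ) ^ (k + 1) * ρ ^ n * ρ⁻¹ :=
    (summable_pow_mul_geometric_of_norm_lt_one (k + 1) hρn).mul_right _
  have hd (n : ℕ) (y : ℂ) (_ : y ∈ Metric.ball (0 : ℂ) ρ) :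
      HasDerivAt (fun w : ℂ => a n * w ^ n) (a n * (n * y ^ (n - 1))) y :=
    (hasDerivAt_pow n y).const_mul _
  have hb (n : ℕ) (y : ℂ) (hy : y ∈ Metric.ball (0 : ℂ) ρ) :
      ‖a n * (n * y ^ (n - 1))‖ ≤ (n : ℝ) ^ (k + 1) * ρ ^ n * ρ⁻¹ := by
    have hy' : ‖y‖ < ρ := by simpa using hy
    rcases Nat.eq_zero_or_pos n with rfl | hn
    · simp
    have h2 : ρ ^ n * ρ⁻¹ = ρ ^ (n - 1) := by
      obtain ⟨j, rfl⟩ : ∃ j, n = j + 1 := ⟨n - 1, by omega⟩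
      simp [pow_succ, hρ0.ne']
    rw [norm_mul, norm_mul, norm_pow, mul_assoc, h2, pow_succ, mul_assoc, Complex.norm_natCast]
    have := ha n
    gcongr
  have h0 : Summable fun n : ℕ => a n * (0 : ℂ) ^ n := by
    refine summable_of_ne_finset_zero (s := {0}) fun n hn => ?_
    have hn0 : n ≠ 0 := by simpa using hn
    simp [hn0]
  exact hasDerivAt_tsum_of_isPreconnected hs Metric.isOpen_ball (convex_ball _ _).isPreconnected
    hd hb (Metric.mem_ball_self hρ0) h0 (mem_ball_zero_iff.mpr hρ1)

lemma norm_exp_two_pi_I_lt_one {z : ℂ} (hz : 0 < z.im) :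
    ‖Complex.exp (2 * Real.pi * Complex.I * z)‖ < 1 :=
  UpperHalfPlane.norm_exp_two_pi_I_lt_one ⟨z, hz⟩

lemma I_mul_deriv_Ek {k : ℕ} (hk : 1 ≤ k) {z : ℂ} (hz : 0 < z.im) {x : ℝ}
    (hx : Complex.exp (2 * Real.pi * Complex.I * z) = x) :
    Complex.I * deriv (Ek k) z
      = ((4 * Real.pi * k / (bernoulli k : ℚ) * thetaSigma k x : ℝ) : ℂ) := by
  have hq := norm_exp_two_pi_I_lt_one hz
  have he : HasDerivAt (fun w : ℂ => Complex.exp (2 * Real.pi * Complex.I * w))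
      (Complex.exp (2 * Real.pi * Complex.I * z) * (2 * Real.pi * Complex.I)) z := by
    simpa using ((hasDerivAt_id z).const_mul (2 * Real.pi * Complex.I)).cexp
  have ha (n : ℕ) : ‖∑ d ∈ n.divisors, (d : ℂ) ^ (k - 1)‖ ≤ (n : ℝ) ^ k := by
    refine (norm_sum_le _ _).trans ?_
    simpa using sum_divisors_pow_le hk n
  have h := (((hasDerivAt_tsum_mul_pow ha hq).comp z he).const_mul
    (2 * (k : ℂ) / ((bernoulli k : ℚ) : ℂ))).const_sub 1
  have h' : HasDerivAt (Ek k) _ z := h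
  rw [h'.deriv, hx]
  have hS : (∑' n : ℕ, (∑ d ∈ n.divisors, (d : ℂ) ^ (k - 1)) * (n * (x : ℂ) ^ (n - 1))) * x
      = (thetaSigma k x : ℂ) := by
    rw [thetaSigma, Complex.ofReal_tsum, ← tsum_mul_right]
    refine tsum_congr fun n => ?_
    rcases Nat.eq_zero_or_pos n with rfl | hn
    · simp
    obtain ⟨j, rfl⟩ : ∃ j, n = j + 1 := ⟨n - 1, by omega⟩
    push_cast
    ring
  push_cast
  rw [← hS]
  linear_combination (-(2 * (k : ℂ) / ((bernoulli k : ℚ) : ℂ)) * (2 * Real.pi) *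
    ((∑' n : ℕ, (∑ d ∈ n.divisors, (d : ℂ) ^ (k - 1)) * (n * (x : ℂ) ^ (n - 1))) * x)) *
    Complex.I_sq

lemma bernoulli_ne_zero_of_even {k : ℕ} (hke : Even k) (hk : k ≠ 0) : bernoulli k ≠ 0 := by
  obtain ⟨j, rfl⟩ := hke
  have hj : j ≠ 0 := by omega
  have h := hasSum_zeta_nat hj
  intro h0
  rw [show 2 * j = j + j by ring, h0] at h
  simp only [Rat.cast_zero, mul_zero, zero_div] at h
  have h1 := (hasSum_zero_iff_of_nonneg (fun n => by positivity)).mp h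
  have := congrFun h1 1
  simp at this

lemma hasSum_thetaSigma {k : ℕ} (hk : 1 ≤ k) {x : ℝ} (hx : |x| < 1) :
    HasSum (fun c : ℕ => ((c : ℝ) + 1) * ∑' n : ℕ, (n : ℝ) ^ k * (x ^ (c + 1)) ^ n)
      (thetaSigma k x) := by
  have hs : Summable fun p : ℕ+ × ℕ+ =>
      (p.1 : ℝ) * ((p.2 : ℝ) ^ k * (x ^ (p.1 : ℕ)) ^ (p.2 : ℕ)) := by
    set s := √|x|
    have hs0 : 0 ≤ s := Real.sqrt_nonneg _
    have hs2 : s ^ 2 = |x| := Real.sq_sqrt (abs_nonneg x)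
    have hs1 : s < 1 := by nlinarith
    have hn : ‖s‖ < 1 := by rwa [Real.norm_of_nonneg hs0]
    have h1 := (summable_pow_mul_geometric_of_norm_lt_one 1 hn).subtype {n : ℕ | 0 < n}
    have h2 := (summable_pow_mul_geometric_of_norm_lt_one k hn).subtype {n : ℕ | 0 < n}
    have h3 := Summable.mul_of_nonneg h1 h2 (fun n => by simp; positivity)
      (fun n => by simp; positivity)
    refine Summable.of_norm_bounded h3 fun p => ?_
    have hp1 := p.1.pos
    have hp2 := p.2.pos
    have h4 : (|x| ^ (p.1 : ℕ)) ^ (p.2 : ℕ) ≤ s ^ (p.1 : ℕ) * s ^ (p.2 : ℕ) := by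
      rw [← hs2, ← pow_mul, ← pow_mul, ← pow_add]
      apply pow_le_pow_of_le_one hs0 hs1.le
      nlinarith
    simp only [norm_mul, norm_pow, Real.norm_eq_abs, Nat.abs_cast]
    change _ ≤ ((p.1 : ℕ) : ℝ) ^ 1 * s ^ (p.1 : ℕ) * (((p.2 : ℕ) : ℝ) ^ k * s ^ (p.2 : ℕ))
    calc _ ≤ ((p.1 : ℕ) : ℝ) * (((p.2 : ℕ) : ℝ) ^ k * (s ^ (p.1 : ℕ) * s ^ (p.2 : ℕ))) := by gcongr
      _ = _ := by ring
  have hrow : ∀ c : ℕ+, ∑' n : ℕ+, (c : ℝ) * ((n : ℝ) ^ k * (x ^ (c : ℕ)) ^ (n : ℕ))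
      = (c : ℝ) * ∑' n : ℕ, (n : ℝ) ^ k * (x ^ (c : ℕ)) ^ n := by
    intro c
    have hxc : ‖x ^ (c : ℕ)‖ < 1 := by
      rw [norm_pow]; exact pow_lt_one₀ (norm_nonneg _) hx c.pos.ne'
    have h := tsum_zero_pnat_eq_tsum_nat (f := fun n : ℕ => (n : ℝ) ^ k * (x ^ (c : ℕ)) ^ n)
      (summable_pow_mul_geometric_of_norm_lt_one k hxc)
    rw [tsum_mul_left, ← h]
    simp [show k ≠ 0 by omega]
  have hA : HasSum (fun c : ℕ => ((c : ℝ) + 1) * ∑' n : ℕ, (n : ℝ) ^ k * (x ^ (c + 1)) ^ n)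
      (∑' p : ℕ+ × ℕ+, (p.1 : ℝ) * ((p.2 : ℝ) ^ k * (x ^ (p.1 : ℕ)) ^ (p.2 : ℕ))) := by
    have h := hs.hasSum.prod_fiberwise fun c => (hs.prod_factor c).hasSum
    simp only [hrow] at h
    have := (Equiv.pnatEquivNat.symm.hasSum_iff).mpr h
    simpa [Function.comp_def] using this
  convert hA using 1
  have hs' := sigmaAntidiagonalEquivProd.summable_iff.mpr hs
  have hn : Summable fun n : ℕ => (n : ℝ) * (∑ d ∈ n.divisors, (d : ℝ) ^ (k - 1)) * x ^ n := by
    refine Summable.of_norm_bounded (summable_pow_mul_geometric_of_norm_lt_one (k + 1)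
      (by simpa using hx : ‖|x|‖ < 1)) fun n => ?_
    have := sum_divisors_pow_le hk n
    rw [norm_mul, norm_mul, norm_pow, Real.norm_eq_abs x, pow_succ', Real.norm_natCast,
      Real.norm_of_nonneg (by positivity)]
    gcongr
  rw [← sigmaAntidiagonalEquivProd.tsum_eq]
  have hsig := Summable.tsum_sigma hs'
  simp only [Function.comp_apply] at hsig
  rw [hsig, thetaSigma, ← tsum_zero_pnat_eq_tsum_nat hn]
  · simp only [Nat.divisors_zero, Finset.sum_empty, mul_zero, zero_mul, CharP.cast_eq_zero, zero_add]
    refine tsum_congr fun n => ?_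
    simp only [sigmaAntidiagonalEquivProd, divisorsAntidiagonalFactors, Equiv.coe_fn_mk,
      PNat.mk_coe, tsum_fintype, Finset.univ_eq_attach]
    rw [(n : ℕ).divisorsAntidiagonal.sum_attach
      (fun p : ℕ × ℕ => (p.1 : ℝ) * ((p.2 : ℝ) ^ k * (x ^ p.1) ^ p.2)),
      Nat.sum_divisorsAntidiagonal' (fun a b : ℕ => (a : ℝ) * ((b : ℝ) ^ k * (x ^ a) ^ b)),
      mul_assoc, Finset.sum_mul, Finset.mul_sum]
    refine Finset.sum_congr rfl fun d hd => ?_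
    have hdn : (n : ℕ) / d * d = n := Nat.div_mul_cancel (Nat.dvd_of_mem_divisors hd)
    rw [← pow_mul, hdn]
    have hdn' : (n : ℝ) = ((n : ℕ) / d : ℕ) * (d : ℝ) := by exact_mod_cast hdn.symm
    obtain ⟨j, rfl⟩ : ∃ j, k = j + 1 := ⟨k - 1, by omega⟩
    rw [hdn', Nat.add_sub_cancel]
    ring

lemma sum_inv_pow_le {l : ℕ} (hl : 5 ≤ l) (n : ℕ) :
    ∑ d ∈ Finset.range (n + 1), ((d : ℝ) + 1)⁻¹ ^ l ≤ 9 / 8 - 1 / (8 * ((n : ℝ) + 1)) := by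
  induction n with
  | zero => norm_num
  | succ n ih =>
    rw [Finset.sum_range_succ]
    have h1 : ((n : ℝ) + 1 + 1)⁻¹ ^ l ≤ 1 / (8 * ((n : ℝ) + 1)) - 1 / (8 * ((n : ℝ) + 1 + 1)) := by
      have h2 : ((n : ℝ) + 1 + 1)⁻¹ ^ l ≤ ((n : ℝ) + 1 + 1)⁻¹ ^ 5 :=
        pow_le_pow_of_le_one (by positivity)
          (inv_le_one_of_one_le₀ (by linarith [n.cast_nonneg (α := ℝ)])) hl
      refine h2.trans ?_
      rw [show (1 : ℝ) / (8 * ((n : ℝ) + 1)) - 1 / (8 * ((n : ℝ) + 1 + 1))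
        = 1 / (8 * ((n : ℝ) + 1) * ((n : ℝ) + 1 + 1)) by field_simp; ring, inv_pow, ← one_div]
      apply one_div_le_one_div_of_le (by positivity)
      have hn : (0 : ℝ) ≤ n := n.cast_nonneg
      have h3 : (2 : ℝ) ^ 3 ≤ ((n : ℝ) + 1 + 1) ^ 3 := by gcongr; linarith
      have h4 : 0 ≤ ((n : ℝ) + 1 + 1) ^ 2 := by positivity
      calc 8 * ((n : ℝ) + 1) * ((n : ℝ) + 1 + 1) ≤ 2 ^ 3 * ((n : ℝ) + 1 + 1) ^ 2 := by nlinarith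
        _ ≤ ((n : ℝ) + 1 + 1) ^ 3 * ((n : ℝ) + 1 + 1) ^ 2 := by gcongr
        _ = _ := by ring
    push_cast
    linarith

lemma sum_divisors_pow_le_mul {l : ℕ} (hl : 5 ≤ l) (n : ℕ) :
    ∑ d ∈ n.divisors, (d : ℝ) ^ l ≤ 9 / 8 * (n : ℝ) ^ l := by
  rcases Nat.eq_zero_or_pos n with rfl | hn
  · simp [show l ≠ 0 by omega]
  obtain ⟨j, rfl⟩ : ∃ j, n = j + 1 := ⟨n - 1, by omega⟩
  rw [← Nat.sum_div_divisors (j + 1) (fun d : ℕ => (d : ℝ) ^ l)]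
  have h1 : ∀ d ∈ (j + 1).divisors,
      (((j + 1) / d : ℕ) : ℝ) ^ l = ((j + 1 : ℕ) : ℝ) ^ l * (d : ℝ)⁻¹ ^ l := by
    intro d hd
    rw [Nat.cast_div (Nat.dvd_of_mem_divisors hd)
      (Nat.cast_ne_zero.mpr (Nat.pos_of_mem_divisors hd).ne'), div_eq_mul_inv, mul_pow]
  rw [Finset.sum_congr rfl h1, ← Finset.mul_sum, mul_comm (9 / 8 : ℝ)]
  refine mul_le_mul_of_nonneg_left ?_ (by positivity)
  have h2 : ∑ d ∈ (j + 1).divisors, (d : ℝ)⁻¹ ^ l ≤ ∑ d ∈ Finset.Ico 1 (j + 2), (d : ℝ)⁻¹ ^ l := by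
    refine Finset.sum_le_sum_of_subset_of_nonneg (fun d hd => ?_) fun _ _ _ => by positivity
    exact Finset.mem_Ico.mpr ⟨Nat.pos_of_mem_divisors hd,
      Nat.lt_succ_of_le (Nat.divisor_le hd)⟩
  rw [Finset.sum_Ico_eq_sum_range] at h2
  have h3 := sum_inv_pow_le hl j
  have h4 : (0 : ℝ) ≤ 1 / (8 * ((j : ℝ) + 1)) := by positivity
  simp only [Nat.cast_add, Nat.cast_one, add_comm (1 : ℝ)] at h2
  rw [show j + 2 - 1 = j + 1 by omega] at h2
  linarith

/-- If `n ↦ n ^ k * y ^ n` drops by a factor at least four on both sides of `n = m`, then the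
`m`-th term determines the sign of `thetaSigma k (-y)`. -/
lemma thetaSigma_neg_sign {k m : ℕ} (hk : 6 ≤ k) (hm : 1 ≤ m) {y : ℝ} (hy0 : 0 < y) (hy1 : y < 1)
    (hr : (1 + 1 / (m : ℝ)) ^ k * y ≤ 1 / 4) (hl : (1 - 1 / (m : ℝ)) ^ k / y ≤ 1 / 4) :
    0 < (-1) ^ m * thetaSigma k (-y) := by
  have hm0 : (0 : ℝ) < m := by exact_mod_cast hm
  have hm1 : 1 / (m : ℝ) ≤ 1 := by
    rw [div_le_one hm0]; exact_mod_cast hm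
  set b : ℕ → ℝ := fun n => (n : ℝ) * ∑ d ∈ n.divisors, (d : ℝ) ^ (k - 1) with hb
  have hkk : ∀ x : ℝ, x * x ^ (k - 1) = x ^ k := fun x => mul_pow_sub_one (by omega) x
  have hb0 : ∀ n, 0 ≤ b n := fun n => by positivity
  have hbu : ∀ n, b n ≤ 9 / 8 * (n : ℝ) ^ k := by
    intro n
    calc b n ≤ (n : ℝ) * (9 / 8 * (n : ℝ) ^ (k - 1)) :=
          mul_le_mul_of_nonneg_left (sum_divisors_pow_le_mul (by omega) n) (by positivity)
      _ = 9 / 8 * (n : ℝ) ^ k := by rw [← hkk]; ring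
  have hbl : (m : ℝ) ^ k ≤ b m := by
    rw [← hkk]
    refine mul_le_mul_of_nonneg_left ?_ hm0.le
    exact Finset.single_le_sum (f := fun d : ℕ => (d : ℝ) ^ (k - 1)) (fun d _ => by positivity)
      (Nat.mem_divisors_self m (by omega))
  set P := (m : ℝ) ^ k * y ^ m with hP
  have hP0 : 0 < P := by positivity
  have hright : ∀ j : ℕ, ‖b (j + (m + 1)) * (-y) ^ (j + (m + 1))‖
      ≤ 9 / 8 * P * (1 / 4) * (1 / 4) ^ j := by
    intro j
    have h1 : ((j + (m + 1) : ℕ) : ℝ) ≤ m * (1 + 1 / (m : ℝ)) ^ (j + 1) := by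
      have := one_add_mul_le_pow (show (-2 : ℝ) ≤ 1 / (m : ℝ) by
        linarith [show 0 < 1 / (m : ℝ) by positivity]) (j + 1)
      calc ((j + (m + 1) : ℕ) : ℝ) = m * (1 + (j + 1 : ℕ) * (1 / (m : ℝ))) := by
            push_cast; field_simp; ring
        _ ≤ _ := by gcongr
    rw [norm_mul, norm_pow, norm_neg, Real.norm_of_nonneg (hb0 _), Real.norm_of_nonneg hy0.le]
    calc b (j + (m + 1)) * y ^ (j + (m + 1))
        ≤ 9 / 8 * (m * (1 + 1 / (m : ℝ)) ^ (j + 1)) ^ k * y ^ (j + (m + 1)) := by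
          gcongr
          exact (hbu _).trans (by gcongr)
      _ = 9 / 8 * P * ((1 + 1 / (m : ℝ)) ^ k * y) ^ (j + 1) := by
          rw [hP, mul_pow, mul_pow, ← pow_mul, ← pow_mul, mul_comm k]; ring
      _ ≤ 9 / 8 * P * (1 / 4) ^ (j + 1) := by gcongr
      _ = _ := by ring
  have hleft : ∀ i ∈ Finset.range m, ‖b i * (-y) ^ i‖ ≤ 9 / 8 * P * (4 ^ i / 4 ^ m) := by
    intro i hi
    obtain ⟨l, rfl⟩ : ∃ l, m = i + l := ⟨m - i, by have := Finset.mem_range.mp hi; omega⟩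
    have h1 : (i : ℝ) ≤ ((i + l : ℕ) : ℝ) * (1 - 1 / ((i + l : ℕ) : ℝ)) ^ l := by
      have := one_add_mul_le_pow (show (-2 : ℝ) ≤ -(1 / ((i + l : ℕ) : ℝ)) by linarith) l
      calc (i : ℝ) = ((i + l : ℕ) : ℝ) * (1 + l * -(1 / ((i + l : ℕ) : ℝ))) := by
            field_simp; push_cast; ring
        _ ≤ _ := by rw [sub_eq_add_neg]; gcongr
    have h2 : 0 ≤ 1 - 1 / ((i + l : ℕ) : ℝ) := by linarith
    rw [norm_mul, norm_pow, norm_neg, Real.norm_of_nonneg (hb0 _), Real.norm_of_nonneg hy0.le]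
    calc b i * y ^ i
        ≤ 9 / 8 * (((i + l : ℕ) : ℝ) * (1 - 1 / ((i + l : ℕ) : ℝ)) ^ l) ^ k * y ^ i := by
          gcongr
          exact (hbu _).trans (by gcongr)
      _ = 9 / 8 * P * ((1 - 1 / ((i + l : ℕ) : ℝ)) ^ k / y) ^ l := by
          rw [hP, mul_pow, div_pow, ← pow_mul, ← pow_mul, mul_comm k, pow_add y]
          field_simp
      _ ≤ 9 / 8 * P * (1 / 4) ^ l := by gcongr
      _ = _ := by rw [pow_add, one_div_pow]; field_simp
  have hgeo : HasSum (fun j : ℕ => 9 / 8 * P * (1 / 4) * (1 / 4 : ℝ) ^ j)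
      (9 / 8 * P * (1 / 4) * (1 - 1 / 4)⁻¹) :=
    (hasSum_geometric_of_lt_one (by norm_num) (by norm_num)).mul_left _
  have hsum : Summable fun n => b n * (-y) ^ n :=
    (summable_nat_add_iff (m + 1)).mp (Summable.of_norm_bounded hgeo.summable hright)
  have hR := tsum_of_norm_bounded hgeo hright
  have hL : ‖∑ i ∈ Finset.range m, b i * (-y) ^ i‖ ≤ 9 / 8 * P * (1 / 3) := by
    refine (norm_sum_le_of_le _ hleft).trans ?_
    rw [← Finset.mul_sum, ← Finset.sum_div, geom_sum_eq (by norm_num)]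
    refine mul_le_mul_of_nonneg_left ?_ (by positivity)
    rw [div_le_iff₀ (by positivity)]
    linarith [show ((4 : ℝ) ^ m - 1) / (4 - 1) = (4 ^ m - 1) / 3 by norm_num]
  have hT : thetaSigma k (-y) = (∑ i ∈ Finset.range m, b i * (-y) ^ i + b m * (-y) ^ m)
      + ∑' j, b (j + (m + 1)) * (-y) ^ (j + (m + 1)) := by
    rw [← Finset.sum_range_succ (fun i => b i * (-y) ^ i), hsum.sum_add_tsum_nat_add]
    rfl
  rw [hT]
  set L := ∑ i ∈ Finset.range m, b i * (-y) ^ i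
  set R := ∑' j, b (j + (m + 1)) * (-y) ^ (j + (m + 1))
  have hone : (-1 : ℝ) ^ m * (-1) ^ m = 1 := by rw [← mul_pow]; norm_num
  have habs : ∀ u : ℝ, -‖u‖ ≤ (-1) ^ m * u := by
    intro u
    have : ‖(-1 : ℝ) ^ m * u‖ = ‖u‖ := by simp
    rw [← this]
    exact neg_abs_le _
  have hmain : P ≤ (-1) ^ m * (b m * (-y) ^ m) := by
    have h1 : (-y) ^ m = (-1) ^ m * y ^ m := by rw [← mul_pow]; ring_nf
    rw [h1, show (-1 : ℝ) ^ m * (b m * ((-1) ^ m * y ^ m)) = ((-1) ^ m * (-1) ^ m) * (b m * y ^ m)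
      by ring, hone, one_mul, hP]
    gcongr
  have e1 := habs L
  have e2 := habs R
  norm_num at hR
  have : (-1 : ℝ) ^ m * (L + b m * (-y) ^ m + R)
      = (-1) ^ m * L + (-1) ^ m * (b m * (-y) ^ m) + (-1) ^ m * R := by ring
  rw [this]
  simp only [Real.norm_eq_abs] at *
  linarith

lemma one_add_le_exp_sub_sq {x : ℝ} (h0 : 0 ≤ x) (h1 : x ≤ 1) :
    1 + x ≤ Real.exp (x - x ^ 2 / 6) := by
  have h := Real.quadratic_le_exp_of_nonneg (show 0 ≤ x - x ^ 2 / 6 by nlinarith)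
  have h2 : x ^ 2 / 6 ≤ (x - x ^ 2 / 6) ^ 2 / 2 := by
    have : (1 / 3 : ℝ) ≤ (1 - x / 6) ^ 2 := by nlinarith
    nlinarith [mul_le_mul_of_nonneg_left this (sq_nonneg x)]
  linarith

lemma one_sub_le_exp_neg_sub_sq {x : ℝ} (h0 : 0 ≤ x) :
    1 - x ≤ Real.exp (-x - x ^ 2 / 2) := by
  have h := Real.le_log_one_add_of_nonneg h0
  have h1 : x - x ^ 2 / 2 ≤ 2 * x / (x + 2) := by
    rw [le_div_iff₀ (by linarith)]
    nlinarith [pow_nonneg h0 3]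
  have h2 : Real.exp (x - x ^ 2 / 2) ≤ 1 + x := by
    rw [← Real.le_log_iff_exp_le (by linarith)]; linarith
  have h3 := Real.one_sub_le_exp_neg (x ^ 2)
  have h4 : Real.exp (-x - x ^ 2 / 2) * Real.exp (x - x ^ 2 / 2) = Real.exp (-x ^ 2) := by
    rw [← Real.exp_add]; ring_nf
  by_contra! hc
  have h5 : Real.exp (-x - x ^ 2 / 2) * (1 + x) < (1 - x) * (1 + x) := by gcongr
  have h6 : Real.exp (-x - x ^ 2 / 2) * Real.exp (x - x ^ 2 / 2)
      ≤ Real.exp (-x - x ^ 2 / 2) * (1 + x) := by gcongr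
  nlinarith

lemma exp_neg_three_halves_le : Real.exp (-(3 / 2)) ≤ 1 / 4 := by
  rw [Real.exp_neg, ← one_div]
  apply one_div_le_one_div_of_le (by norm_num)
  have h := Real.sum_le_exp_of_nonneg (show (0 : ℝ) ≤ 3 / 2 by norm_num) 5
  norm_num [Finset.sum_range_succ, Nat.factorial] at h
  linarith

lemma thetaSigma_sign_of_sq_le {k m : ℕ} (hk : 6 ≤ k) (hm : 1 ≤ m) (hmk : 9 * m ^ 2 ≤ k) :
    0 < (-1) ^ m * thetaSigma k (-Real.exp (-(Real.pi * Real.cot (m * Real.pi / (k + 1))))) := by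
  set φ : ℝ := m * Real.pi / (k + 1) with hφ
  set x : ℝ := 1 / m with hx
  have hm1 : (1 : ℝ) ≤ m := by exact_mod_cast hm
  have hm0 : (0 : ℝ) < m := by linarith
  have hmk' : 9 * (m : ℝ) ^ 2 ≤ k := by exact_mod_cast hmk
  have hk0 : (0 : ℝ) < k + 1 := by positivity
  have hx0 : 0 < x := by positivity
  have hx1 : x ≤ 1 := by rw [hx, div_le_one hm0]; exact hm1
  have hkx : 9 ≤ k * x ^ 2 := by
    rw [hx, div_pow, one_pow, mul_one_div, le_div_iff₀ (by positivity)]; exact hmk'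
  have hπ := Real.pi_lt_d2
  have hπ0 := Real.pi_pos
  have hφ0 : 0 < φ := by positivity
  have hφ1 : φ < Real.pi / 2 := by
    rw [hφ, div_lt_div_iff₀ hk0 (by norm_num)]
    have h1 : 2 * (m : ℝ) < k + 1 := by nlinarith
    nlinarith
  have hsin : 0 < Real.sin φ := Real.sin_pos_of_pos_of_lt_pi hφ0 (by linarith)
  have hcos : 0 < Real.cos φ := Real.cos_pos_of_mem_Ioo ⟨by linarith, hφ1⟩
  have hπφ : Real.pi / φ = (k + 1) * x := by rw [hφ, hx]; field_simp
  have hcu : Real.pi * Real.cot φ ≤ (k + 1) * x := by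
    rw [← hπφ, Real.cot_eq_cos_div_sin, div_eq_mul_one_div Real.pi]
    refine mul_le_mul_of_nonneg_left ?_ hπ0.le
    rw [div_le_div_iff₀ hsin hφ0]
    have := Real.lt_tan hφ0 hφ1
    rw [Real.tan_eq_sin_div_cos, lt_div_iff₀ hcos] at this
    linarith
  have hcl : k * x ≤ Real.pi * Real.cot φ := by
    have h1 : 1 / φ - φ / 2 ≤ Real.cot φ := by
      rw [Real.cot_eq_cos_div_sin, le_div_iff₀ hsin]
      have h2 : Real.sin φ ≤ φ := Real.sin_le hφ0.le
      have h3 := Real.one_sub_sq_div_two_le_cos (x := φ)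
      have h4 : 0 ≤ 1 / φ - φ / 2 := by
        rw [sub_nonneg, div_le_div_iff₀ (by norm_num) hφ0]
        have : φ * (k + 1) = m * Real.pi := by rw [hφ]; field_simp
        have h5 : φ * φ * (k + 1) ^ 2 = m ^ 2 * Real.pi ^ 2 := by
          rw [show φ * φ * (k + 1) ^ 2 = (φ * (k + 1)) ^ 2 by ring, this]; ring
        by_contra! hc
        have h6 : 1 * 2 * ((k : ℝ) + 1) ^ 2 < m ^ 2 * Real.pi ^ 2 := by
          rw [← h5]; gcongr
        have h7 : Real.pi ^ 2 ≤ 10 := by nlinarith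
        nlinarith
      calc (1 / φ - φ / 2) * Real.sin φ ≤ (1 / φ - φ / 2) * φ := by gcongr
        _ = 1 - φ ^ 2 / 2 := by field_simp
        _ ≤ _ := h3
    have h2 : Real.pi * (1 / φ - φ / 2) ≤ Real.pi * Real.cot φ := by gcongr
    have h3 : Real.pi * φ / 2 ≤ x := by
      rw [hφ, hx, div_le_div_iff₀ (by norm_num) hm0, mul_div_assoc', div_mul_eq_mul_div,
        div_le_iff₀ hk0]
      have h7 : Real.pi ^ 2 ≤ 10 := by nlinarith
      nlinarith [mul_le_mul_of_nonneg_left h7 (sq_nonneg (m : ℝ))]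
    have h4 : Real.pi * (1 / φ - φ / 2) = Real.pi / φ - Real.pi * φ / 2 := by ring
    rw [h4, hπφ] at h2
    linarith
  have hcpos : 0 < Real.pi * Real.cot φ := lt_of_lt_of_le (by positivity) hcl
  refine thetaSigma_neg_sign hk hm (Real.exp_pos _) (by rw [Real.exp_lt_one_iff]; linarith) ?_ ?_
  · rw [← hx]
    calc (1 + x) ^ k * Real.exp (-(Real.pi * Real.cot φ))
        ≤ Real.exp (x - x ^ 2 / 6) ^ k * Real.exp (-(k * x)) := by
          gcongr
          exact one_add_le_exp_sub_sq hx0.le hx1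
      _ = Real.exp (-(k * x ^ 2 / 6)) := by
          rw [← Real.exp_nat_mul, ← Real.exp_add]; ring_nf
      _ ≤ Real.exp (-(3 / 2)) := Real.exp_le_exp.mpr (by linarith)
      _ ≤ 1 / 4 := exp_neg_three_halves_le
  · rw [← hx, div_eq_mul_inv, ← Real.exp_neg, neg_neg]
    calc (1 - x) ^ k * Real.exp (Real.pi * Real.cot φ)
        ≤ Real.exp (-x - x ^ 2 / 2) ^ k * Real.exp ((k + 1) * x) := by
          have h1 : 0 ≤ 1 - x := by linarith
          gcongr
          exact one_sub_le_exp_neg_sub_sq hx0.le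
      _ = Real.exp (-(k * x ^ 2 / 2 - x)) := by
          rw [← Real.exp_nat_mul, ← Real.exp_add]; ring_nf
      _ ≤ Real.exp (-(3 / 2)) := Real.exp_le_exp.mpr (by linarith)
      _ ≤ 1 / 4 := exp_neg_three_halves_le

lemma hasSum_one_div_mul_succ :
    HasSum (fun n : ℕ => 1 / (((n : ℝ) + 1) * ((n : ℝ) + 2))) 1 := by
  rw [hasSum_iff_tendsto_nat_of_nonneg fun n => by positivity]
  have h : ∀ n : ℕ, ∑ i ∈ Finset.range n, 1 / (((i : ℝ) + 1) * ((i : ℝ) + 2))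
      = 1 - 1 / ((n : ℝ) + 1) := by
    intro n
    induction n with
    | zero => simp
    | succ n ih =>
      rw [Finset.sum_range_succ, ih]
      push_cast
      field_simp
      ring
  simp only [h]
  simpa using (tendsto_one_div_add_atTop_nhds_zero_nat (𝕜 := ℝ)).const_sub 1

lemma hasSum_one_div_succ_sq :
    HasSum (fun n : ℕ => 1 / ((n : ℝ) + 1) ^ 2) (Real.pi ^ 2 / 6) := by
  simpa using (hasSum_nat_add_iff' 1).mpr hasSum_zeta_two

/-- The Lipschitz summation formula, rotated so that the summands are close to real. -/
lemma lipschitz_formula {k : ℕ} (hk : 1 ≤ k) (x : ℝ) {y : ℝ} (hy : 0 < y) :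
    ∑' d : ℤ, 1 / ((y : ℂ) - (x + d) * Complex.I) ^ (k + 1)
      = (2 * Real.pi) ^ (k + 1) / k.factorial *
        ∑' n : ℕ, (n : ℂ) ^ k * Complex.exp (2 * Real.pi * Complex.I * (x + y * Complex.I)) ^ n := by
  have h := EisensteinSeries.qExpansion_identity hk ⟨x + y * Complex.I, by simpa using hy⟩
  have h1 : ∀ d : ℤ, 1 / ((y : ℂ) - (x + d) * Complex.I) ^ (k + 1)
      = Complex.I ^ (k + 1) * (1 / ((x + y * Complex.I : ℂ) + d) ^ (k + 1)) := by
    intro d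
    have h2 : (x + y * Complex.I : ℂ) + d = Complex.I * (y - (x + d) * Complex.I) := by
      linear_combination (x + d : ℂ) * Complex.I_sq
    rw [h2, mul_pow]
    have := pow_ne_zero (k + 1) Complex.I_ne_zero
    rw [mul_one_div, div_mul_eq_div_div, div_self this]
  simp only [h1]
  rw [tsum_mul_left]
  change Complex.I ^ (k + 1) * ∑' d : ℤ, 1 / ((x + y * Complex.I : ℂ) + d) ^ (k + 1) = _
  have h' : ∑' d : ℤ, 1 / ((x + y * Complex.I : ℂ) + d) ^ (k + 1) = _ := h
  rw [h', ← mul_assoc]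
  congr 1
  rw [← mul_div_assoc, ← mul_pow]
  congr 2
  linear_combination (-2 * Real.pi : ℂ) * Complex.I_sq

lemma one_div_norm_pow_le {k : ℕ} (hke : Even k) (hk : 1 ≤ k) {w : ℂ} {A s : ℝ} (hA : 0 < A)
    (hs : 0 < s) (hw : ‖w‖ ^ 2 = A ^ 2 * (1 + s)) :
    ‖1 / w ^ (k + 1)‖ ≤ 1 / A ^ (k + 1) * (2 / (k * s)) := by
  obtain ⟨j, rfl⟩ := hke
  have hj : (0 : ℝ) < j := by
    have : 0 < j := by omega
    exact_mod_cast this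
  have h1 : A ≤ ‖w‖ := by
    refine le_of_sq_le_sq ?_ (norm_nonneg w)
    rw [hw]; nlinarith [sq_nonneg A]
  have h2 : A ^ (j + j + 1) * ((j + j : ℕ) * s / 2) ≤ ‖w‖ ^ (j + j + 1) := by
    have hB := one_add_mul_le_pow (show (-2 : ℝ) ≤ s by linarith) j
    have e1 : ‖w‖ ^ (j + j + 1) = (A ^ 2 * (1 + s)) ^ j * ‖w‖ := by
      rw [← hw, ← pow_mul, ← two_mul, pow_succ]
    rw [e1]
    calc A ^ (j + j + 1) * ((j + j : ℕ) * s / 2) = ((A ^ 2) ^ j * (j * s)) * A := by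
          push_cast; rw [← pow_mul]; ring
      _ ≤ ((A ^ 2) ^ j * (1 + s) ^ j) * ‖w‖ := by
          gcongr
          linarith
      _ = _ := by rw [mul_pow]
  rw [norm_div, norm_one, norm_pow]
  have h3 : 1 / A ^ (j + j + 1) * (2 / ((j + j : ℕ) * s))
      = 1 / (A ^ (j + j + 1) * ((j + j : ℕ) * s / 2)) := by
    field_simp
  rw [h3]
  apply one_div_le_one_div_of_le _ h2
  push_cast
  positivity

lemma norm_real_sub_mul_I_sq (y v : ℝ) : ‖(y : ℂ) - v * Complex.I‖ ^ 2 = y ^ 2 + v ^ 2 := by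
  rw [← Complex.normSq_eq_norm_sq]
  simp [Complex.normSq_apply]
  ring

/-- On the imaginary axis, the Lipschitz series is dominated by its central term. -/
lemma tsum_pow_mul_exp_le {k : ℕ} (hke : Even k) (hk : 1 ≤ k) {y : ℝ} (hy : 0 < y) :
    (2 * Real.pi) ^ (k + 1) / k.factorial *
      ∑' n : ℕ, (n : ℝ) ^ k * Real.exp (-(2 * Real.pi * y)) ^ n
      ≤ 1 / y ^ (k + 1) * (1 + 8 * y ^ 2 / k) := by
  have hk0 : (0 : ℝ) < k := by exact_mod_cast hk
  have hL := lipschitz_formula hk 0 hy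
  set f : ℤ → ℂ := fun d => 1 / ((y : ℂ) - ((0 : ℝ) + d) * Complex.I) ^ (k + 1) with hf
  set g : ℕ → ℝ := fun n => 1 / y ^ (k + 1) * (2 * y ^ 2 / k) * (1 / ((n : ℝ) + 1) ^ 2) with hg
  have hgs : HasSum g (1 / y ^ (k + 1) * (2 * y ^ 2 / k) * (Real.pi ^ 2 / 6)) :=
    hasSum_one_div_succ_sq.mul_left _
  have hbound : ∀ (n : ℕ) (v : ℝ), v ^ 2 = ((n : ℝ) + 1) ^ 2 →
      ‖1 / ((y : ℂ) - v * Complex.I) ^ (k + 1)‖ ≤ g n := by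
    intro n v hv
    refine (one_div_norm_pow_le hke hk hy (s := ((n : ℝ) + 1) ^ 2 / y ^ 2) (by positivity)
      ?_).trans_eq ?_
    · rw [norm_real_sub_mul_I_sq, hv]; field_simp
    · rw [hg]; field_simp
  have h1 : ∀ n : ℕ, ‖f ((n + 1 : ℕ) : ℤ)‖ ≤ g n := by
    intro n
    have := hbound n ((n : ℝ) + 1) rfl
    simpa [hf] using this
  have h2 : ∀ n : ℕ, ‖f (-(n + 1))‖ ≤ g n := by
    intro n
    have := hbound n (-((n : ℝ) + 1)) (by ring)
    simpa [hf] using this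
  have s1' := Summable.of_norm_bounded hgs.summable h1
  have s1 : Summable fun n : ℕ => f n := (summable_nat_add_iff 1).mp s1'
  have s2 := Summable.of_norm_bounded hgs.summable h2
  rw [tsum_of_nat_of_neg_add_one s1 s2, s1.tsum_eq_zero_add] at hL
  have n1 := tsum_of_norm_bounded hgs h1
  have n2 := tsum_of_norm_bounded hgs h2
  have n0 : ‖f ((0 : ℕ) : ℤ)‖ = 1 / y ^ (k + 1) := by
    simp [hf, abs_of_pos hy]
  have hexp : Complex.exp (2 * Real.pi * Complex.I * ((0 : ℝ) + y * Complex.I))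
      = (Real.exp (-(2 * Real.pi * y)) : ℂ) := by
    push_cast
    congr 1
    linear_combination (2 * Real.pi * y : ℂ) * Complex.I_sq
  rw [hexp] at hL
  have hR : ((2 * Real.pi : ℂ)) ^ (k + 1) / k.factorial *
        ∑' n : ℕ, (n : ℂ) ^ k * (Real.exp (-(2 * Real.pi * y)) : ℂ) ^ n
      = (((2 * Real.pi) ^ (k + 1) / k.factorial *
        ∑' n : ℕ, (n : ℝ) ^ k * Real.exp (-(2 * Real.pi * y)) ^ n : ℝ) : ℂ) := by
    push_cast
    rfl
  rw [hR] at hL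
  have hnorm := congrArg norm hL
  rw [Complex.norm_real] at hnorm
  refine (Real.le_norm_self _).trans (hnorm.symm.le.trans ?_)
  refine (norm_add_le _ _).trans ((add_le_add (norm_add_le _ _) le_rfl).trans ?_)
  rw [n0]
  have hpi : Real.pi ^ 2 / 6 ≤ 2 := by nlinarith [Real.pi_lt_d2, Real.pi_pos]
  have hC : 1 / y ^ (k + 1) * (2 * y ^ 2 / k) * (Real.pi ^ 2 / 6)
      ≤ 1 / y ^ (k + 1) * (2 * y ^ 2 / k) * 2 := by gcongr
  have e : 1 / y ^ (k + 1) * (1 + 8 * y ^ 2 / k)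
      = 1 / y ^ (k + 1) + 1 / y ^ (k + 1) * (2 * y ^ 2 / k) * 2
        + 1 / y ^ (k + 1) * (2 * y ^ 2 / k) * 2 := by ring
  rw [e]
  linarith

/-- On the line `Re z = 1 / 2`, the Lipschitz series is dominated by its two central terms. -/
lemma abs_tsum_pow_mul_neg_exp_sub_le {k : ℕ} (hke : Even k) (hk : 1 ≤ k) {t r α : ℝ} (ht : 0 < t)
    (hr : 0 < r) (htr : (t : ℂ) - 1 / 2 * Complex.I = r * Complex.exp (-(α * Complex.I))) :
    |(2 * Real.pi) ^ (k + 1) / k.factorial *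
      ∑' n : ℕ, (n : ℝ) ^ k * (-Real.exp (-(2 * Real.pi * t))) ^ n
      - 1 / r ^ (k + 1) * (2 * Real.cos ((k + 1) * α))|
      ≤ 1 / r ^ (k + 1) * (4 * r ^ 2 / k) := by
  have hk0 : (0 : ℝ) < k := by exact_mod_cast hk
  have hr2 : r ^ 2 = t ^ 2 + 1 / 4 := by
    have h := norm_real_sub_mul_I_sq t (1 / 2)
    rw [show ((1 / 2 : ℝ) : ℂ) = 1 / 2 by norm_num, htr, norm_mul, Complex.norm_real,
      show -(α * Complex.I) = ((-α : ℝ) : ℂ) * Complex.I by push_cast; ring,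
      Complex.norm_exp_ofReal_mul_I, Real.norm_of_nonneg hr.le] at h
    linarith
  have hL := lipschitz_formula hk (1 / 2) ht
  set f : ℤ → ℂ := fun d => 1 / ((t : ℂ) - ((1 / 2 : ℝ) + d) * Complex.I) ^ (k + 1) with hf
  set g : ℕ → ℝ := fun n =>
    1 / r ^ (k + 1) * (2 * r ^ 2 / k) * (1 / (((n : ℝ) + 1) * ((n : ℝ) + 2))) with hg
  have hgs : HasSum g (1 / r ^ (k + 1) * (2 * r ^ 2 / k) * 1) :=
    hasSum_one_div_mul_succ.mul_left _
  have hbound : ∀ (n : ℕ) (v : ℝ), v ^ 2 = ((n : ℝ) + 3 / 2) ^ 2 →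
      ‖1 / ((t : ℂ) - v * Complex.I) ^ (k + 1)‖ ≤ g n := by
    intro n v hv
    refine (one_div_norm_pow_le hke hk hr (s := ((n : ℝ) + 1) * ((n : ℝ) + 2) / r ^ 2)
      (by positivity) ?_).trans_eq ?_
    · rw [norm_real_sub_mul_I_sq, hv]; field_simp; rw [hr2]; ring
    · rw [hg]; field_simp
  have h1 : ∀ n : ℕ, ‖f ((n + 1 : ℕ) : ℤ)‖ ≤ g n := by
    intro n
    have := hbound n (1 / 2 + ((n : ℝ) + 1)) (by ring)
    simpa [hf] using this
  have h2 : ∀ n : ℕ, ‖f (-((n + 1 : ℕ) + 1))‖ ≤ g n := by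
    intro n
    have := hbound n (1 / 2 + (-1 + -((n : ℝ) + 1))) (by ring)
    simpa [hf] using this
  have s1' := Summable.of_norm_bounded hgs.summable h1
  have s1 : Summable fun n : ℕ => f n := (summable_nat_add_iff 1).mp s1'
  have s2' := Summable.of_norm_bounded hgs.summable h2
  have s2 : Summable fun n : ℕ => f (-(n + 1)) :=
    (summable_nat_add_iff (f := fun n : ℕ => f (-(n + 1))) 1).mp s2'
  rw [tsum_of_nat_of_neg_add_one s1 s2, s1.tsum_eq_zero_add, s2.tsum_eq_zero_add] at hL
  have n1 := tsum_of_norm_bounded hgs h1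
  have n2 := tsum_of_norm_bounded hgs h2
  have hc : f ((0 : ℕ) : ℤ) + f (-(((0 : ℕ) : ℤ) + 1))
      = ((1 / r ^ (k + 1) * (2 * Real.cos ((k + 1) * α)) : ℝ) : ℂ) := by
    have a1 : f ((0 : ℕ) : ℤ)
        = 1 / (r : ℂ) ^ (k + 1) * Complex.exp (((k + 1) * α : ℂ) * Complex.I) := by
      have : f ((0 : ℕ) : ℤ) = 1 / ((t : ℂ) - 1 / 2 * Complex.I) ^ (k + 1) := by simp [hf]
      rw [this, htr, mul_pow, ← Complex.exp_nat_mul, one_div, mul_inv, ← Complex.exp_neg, one_div]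
      congr 2
      push_cast; ring
    have htr' : (t : ℂ) + 1 / 2 * Complex.I = r * Complex.exp (α * Complex.I) := by
      have := congrArg (starRingEnd ℂ) htr
      simpa [← Complex.exp_conj, Complex.conj_ofNat] using this
    have a2 : f (-(((0 : ℕ) : ℤ) + 1))
        = 1 / (r : ℂ) ^ (k + 1) * Complex.exp (-((k + 1) * α : ℂ) * Complex.I) := by
      have : f (-(((0 : ℕ) : ℤ) + 1)) = 1 / ((t : ℂ) + 1 / 2 * Complex.I) ^ (k + 1) := by
        simp only [hf]
        congr 2
        push_cast; ring
      rw [this, htr', mul_pow, ← Complex.exp_nat_mul, one_div, mul_inv, ← Complex.exp_neg, one_div]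
      congr 2
      push_cast; ring
    rw [a1, a2]
    push_cast
    rw [Complex.two_cos]
    ring
  have hexp : Complex.exp (2 * Real.pi * Complex.I * ((1 / 2 : ℝ) + t * Complex.I))
      = ((-Real.exp (-(2 * Real.pi * t)) : ℝ) : ℂ) := by
    have : 2 * Real.pi * Complex.I * ((1 / 2 : ℝ) + t * Complex.I)
        = ((-(2 * Real.pi * t) : ℝ) : ℂ) + Real.pi * Complex.I := by
      push_cast
      linear_combination (2 * Real.pi * t : ℂ) * Complex.I_sq
    rw [this, Complex.exp_add, Complex.exp_pi_mul_I]
    push_cast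
    ring
  rw [hexp] at hL
  have hR : ((2 * Real.pi : ℂ)) ^ (k + 1) / k.factorial *
        ∑' n : ℕ, (n : ℂ) ^ k * ((-Real.exp (-(2 * Real.pi * t)) : ℝ) : ℂ) ^ n
      = (((2 * Real.pi) ^ (k + 1) / k.factorial *
        ∑' n : ℕ, (n : ℝ) ^ k * (-Real.exp (-(2 * Real.pi * t))) ^ n : ℝ) : ℂ) := by
    push_cast
    rfl
  rw [hR] at hL
  rw [← Real.norm_eq_abs, ← Complex.norm_real, Complex.ofReal_sub, ← hL, ← hc]
  calc _ = ‖(∑' n : ℕ, f ((n + 1 : ℕ) : ℤ)) + ∑' n : ℕ, f (-((n + 1 : ℕ) + 1))‖ := by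
        congr 1; ring
    _ ≤ _ := norm_add_le _ _
    _ ≤ _ := add_le_add n1 n2
    _ = _ := by ring

lemma mul_one_div_pow_mul_le {k : ℕ} (hk : 10 ≤ k) {a t r : ℝ} (ha : 2 ≤ a)
    (ht : 0 < t) (hr : 0 < r) (ht2 : 3 / 4 ≤ t ^ 2) (hr2 : r ^ 2 = t ^ 2 + 1 / 4)
    (hrk : 3 * r ^ 2 ≤ k) :
    a * (1 / (a * t) ^ (k + 1) * (1 + 8 * (a * t) ^ 2 / k))
      ≤ 1 / r ^ (k + 1) * (1 / 5 * (1 / ((a - 1) * a))) := by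
  have hk0 : (0 : ℝ) < k := by positivity
  have ha0 : 0 < a := by linarith
  have hat : 0 < a * t := by positivity
  have hra : r ≤ a * t := by
    refine le_of_sq_le_sq ?_ hat.le
    nlinarith [mul_le_mul_of_nonneg_right (show (4 : ℝ) ≤ a ^ 2 by nlinarith) (sq_nonneg t)]
  have hu : (r / (a * t)) ^ 2 ≤ 4 / (3 * a ^ 2) := by
    rw [div_pow, mul_pow, div_le_div_iff₀ (by positivity) (by positivity), hr2]
    nlinarith [mul_le_mul_of_nonneg_left ht2 (sq_nonneg a)]
  have hu1 : r / (a * t) ≤ 1 := (div_le_one hat).mpr hra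
  have h1 : 1 / (a * t) ^ (k + 1) ≤ 1 / r ^ (k + 1) * (4 / (3 * a ^ 2)) ^ 5 := by
    have e : 1 / (a * t) ^ (k + 1) = 1 / r ^ (k + 1) * (r / (a * t)) ^ (k + 1) := by
      rw [div_pow]; field_simp
    rw [e]
    gcongr
    calc (r / (a * t)) ^ (k + 1) ≤ (r / (a * t)) ^ 10 :=
          pow_le_pow_of_le_one (by positivity) hu1 (by omega)
      _ = ((r / (a * t)) ^ 2) ^ 5 := by rw [← pow_mul]
      _ ≤ _ := by gcongr
  have h2 : 1 + 8 * (a * t) ^ 2 / k ≤ 35 / 12 * a ^ 2 := by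
    have h3 : 8 * (a * t) ^ 2 / k ≤ 8 / 3 * a ^ 2 := by
      rw [div_le_iff₀ hk0]
      nlinarith [mul_le_mul_of_nonneg_left (show 3 * t ^ 2 ≤ k by linarith) (sq_nonneg a)]
    nlinarith
  calc a * (1 / (a * t) ^ (k + 1) * (1 + 8 * (a * t) ^ 2 / k))
      ≤ a * (1 / r ^ (k + 1) * (4 / (3 * a ^ 2)) ^ 5 * (35 / 12 * a ^ 2)) := by gcongr
    _ = 1 / r ^ (k + 1) * (8960 / 729 / a ^ 7) := by field_simp; norm_num
    _ ≤ _ := by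
      gcongr
      have ha1 : 0 < a - 1 := by linarith
      rw [one_div_mul_one_div, div_le_div_iff₀ (by positivity) (by positivity)]
      have h4 : (2 : ℝ) ^ 4 ≤ a ^ 4 := by gcongr
      have h5 : 4 * (a - 1) ≤ a ^ 2 := by nlinarith [sq_nonneg (a - 2)]
      have h6 : 2 ^ 4 * a * (4 * (a - 1)) ≤ a ^ 4 * a * a ^ 2 := by gcongr
      have h7 : 0 < (a - 1) * a := by positivity
      nlinarith

/-- Approximating by the two lattice points nearest to the origin: the sign is that of
`cos ((k + 1) α)`, `π / 2 - α` being the argument of `1 / 2 + i cot α / 2`. -/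
lemma thetaSigma_sign_of_cos {k : ℕ} (hke : Even k) (hk : 10 ≤ k) {α : ℝ} (hα0 : 0 < α)
    (hα : α ≤ Real.pi / 6) (hs : 3 ≤ k * (2 * Real.sin α) ^ 2)
    (hc : 4 / 5 ≤ |Real.cos ((k + 1) * α)|) :
    0 < Real.cos ((k + 1) * α) * thetaSigma k (-Real.exp (-(Real.pi * Real.cot α))) := by
  have hpi := Real.pi_pos
  have hk0 : (0 : ℝ) < k := by positivity
  have hsin : 0 < Real.sin α := Real.sin_pos_of_pos_of_lt_pi hα0 (by linarith)
  have hsin' : Real.sin α ≤ 1 / 2 := by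
    rw [← Real.sin_pi_div_six]
    exact Real.sin_le_sin_of_le_of_le_pi_div_two (by linarith) (by linarith) hα
  have hcos : 0 < Real.cos α := Real.cos_pos_of_mem_Ioo ⟨by linarith, by linarith⟩
  set t := Real.cot α / 2 with ht_def
  set r := 1 / (2 * Real.sin α) with hr_def
  have ht_eq : t = Real.cos α / (2 * Real.sin α) := by
    rw [ht_def, Real.cot_eq_cos_div_sin]; field_simp
  have ht : 0 < t := by rw [ht_eq]; positivity
  have hr : 0 < r := by positivity
  have hr2 : r ^ 2 = t ^ 2 + 1 / 4 := by
    rw [ht_eq, hr_def]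
    field_simp
    linarith [Real.sin_sq_add_cos_sq α]
  have hr1 : 1 ≤ r := by
    rw [hr_def, le_div_iff₀ (by positivity)]; linarith
  have ht2 : 3 / 4 ≤ t ^ 2 := by nlinarith
  have hrk : 3 * r ^ 2 ≤ k := by
    rw [hr_def, div_pow, one_pow, mul_one_div, div_le_iff₀ (by positivity)]
    exact hs
  have htr : (t : ℂ) - 1 / 2 * Complex.I = r * Complex.exp (-(α * Complex.I)) := by
    have hsc : (Complex.sin α) ≠ 0 := by
      rw [← Complex.ofReal_sin]; exact_mod_cast hsin.ne'
    rw [ht_eq, hr_def, ← neg_mul, Complex.exp_mul_I, Complex.cos_neg, Complex.sin_neg]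
    push_cast
    field_simp
    ring
  have hx : Real.pi * Real.cot α = 2 * Real.pi * t := by rw [ht_def]; ring
  rw [hx]
  set x := -Real.exp (-(2 * Real.pi * t)) with hx_def
  have hxabs : |x| = Real.exp (-(2 * Real.pi * t)) := by
    rw [hx_def, abs_neg, abs_of_pos (Real.exp_pos _)]
  have hx1 : |x| < 1 := by
    rw [hxabs, Real.exp_lt_one_iff]
    have : 0 < 2 * Real.pi * t := by positivity
    linarith
  set K := (2 * Real.pi) ^ (k + 1) / k.factorial with hK_def
  have hK : 0 < K := by positivity
  have hmain := abs_tsum_pow_mul_neg_exp_sub_le hke (by omega) ht hr htr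
  have hH := (hasSum_nat_add_iff' 1).mpr
    ((hasSum_thetaSigma (by omega : 1 ≤ k) hx1).mul_left K)
  have hbound : ∀ c : ℕ, ‖K * ((((c + 1 : ℕ) : ℝ) + 1) *
      ∑' n : ℕ, (n : ℝ) ^ k * (x ^ (c + 1 + 1)) ^ n)‖
      ≤ 1 / r ^ (k + 1) * (1 / 5) * (1 / (((c : ℝ) + 1) * ((c : ℝ) + 2))) := by
    intro c
    have hxc : |x ^ (c + 1 + 1)| = Real.exp (-(2 * Real.pi * (((c : ℝ) + 2) * t))) := by
      rw [abs_pow, hxabs, ← Real.exp_nat_mul]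
      congr 1
      push_cast
      ring
    have hxc1 : ‖x ^ (c + 1 + 1)‖ < 1 := by
      rw [norm_pow]
      exact pow_lt_one₀ (norm_nonneg _) hx1 (by omega)
    have hsum := (summable_pow_mul_geometric_of_norm_lt_one k hxc1).norm
    have hle := norm_tsum_le_tsum_norm hsum
    simp only [norm_mul, norm_pow, Real.norm_natCast] at hle
    simp only [← norm_pow] at hle
    have h := tsum_pow_mul_exp_le hke (by omega : 1 ≤ k)
      (y := ((c : ℝ) + 2) * t) (by positivity)
    rw [← hxc, ← Real.norm_eq_abs] at h
    have hreal := mul_one_div_pow_mul_le hk (a := (c : ℝ) + 2)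
      (by linarith [(Nat.cast_nonneg c : (0 : ℝ) ≤ c)]) ht hr ht2 hr2 hrk
    rw [norm_mul, norm_mul, Real.norm_of_nonneg hK.le,
      Real.norm_of_nonneg (by positivity : (0 : ℝ) ≤ ((c + 1 : ℕ) : ℝ) + 1)]
    have e1 : ((c + 1 : ℕ) : ℝ) + 1 = c + 2 := by push_cast; ring
    have e2 : (c : ℝ) + 2 - 1 = c + 1 := by ring
    rw [e1]
    rw [e2] at hreal
    calc K * (((c : ℝ) + 2) * ‖∑' n : ℕ, (n : ℝ) ^ k * (x ^ (c + 1 + 1)) ^ n‖)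
        = ((c : ℝ) + 2) * (K * ‖∑' n : ℕ, (n : ℝ) ^ k * (x ^ (c + 1 + 1)) ^ n‖) := by ring
      _ ≤ ((c : ℝ) + 2) * (K * ∑' n : ℕ, (n : ℝ) ^ k * ‖x ^ (c + 1 + 1)‖ ^ n) := by
        gcongr
        simpa only [norm_pow] using hle
      _ ≤ _ := mul_le_mul_of_nonneg_left h (by positivity)
      _ ≤ _ := hreal
      _ = _ := by ring
  have htail := tsum_of_norm_bounded (hasSum_one_div_mul_succ.mul_left _) hbound
  rw [hH.tsum_eq] at htail
  simp only [Finset.sum_range_one, Nat.cast_zero, zero_add, one_mul, pow_one, mul_one,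
    Real.norm_eq_abs] at htail
  have hrinv : 0 < 1 / r ^ (k + 1) := by positivity
  have h43 : 4 * r ^ 2 / k ≤ 4 / 3 := by
    rw [div_le_div_iff₀ hk0 (by norm_num)]; linarith
  have hmain' := hmain.trans (mul_le_mul_of_nonneg_left h43 hrinv.le)
  rw [abs_le] at hmain' htail
  set R := 1 / r ^ (k + 1)
  set C := Real.cos ((k + 1) * α)
  rcases le_total 0 C with hC | hC
  · rw [abs_of_nonneg hC] at hc
    refine mul_pos (by linarith) (pos_of_mul_pos_right (a := K) ?_ hK.le)
    nlinarith [mul_le_mul_of_nonneg_left hc hrinv.le]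
  · rw [abs_of_nonpos hC] at hc
    refine mul_pos_of_neg_of_neg (by linarith) ?_
    have : K * thetaSigma k x < 0 := by
      nlinarith [mul_le_mul_of_nonneg_left hc hrinv.le]
    exact (pos_iff_neg_of_mul_neg this).mp hK

lemma thetaSigma_sign {k m : ℕ} (hke : Even k) (hk : 10 ≤ k) (hm : 1 ≤ m) (hmk : 6 * m ≤ k) :
    0 < (-1) ^ m * thetaSigma k (-Real.exp (-(Real.pi * Real.cot (m * Real.pi / (k + 1))))) := by
  rcases le_or_gt (9 * m ^ 2) k with h | h
  · exact thetaSigma_sign_of_sq_le (by omega) hm h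
  have hpi := Real.pi_pos
  have hm0 : (1 : ℝ) ≤ m := by exact_mod_cast hm
  have hk0 : (10 : ℝ) ≤ k := by exact_mod_cast hk
  have hmk' : 6 * (m : ℝ) ≤ k := by exact_mod_cast hmk
  have h' : (k : ℝ) + 1 ≤ 9 * (m : ℝ) ^ 2 := by exact_mod_cast h
  set φ : ℝ := m * Real.pi / (k + 1) with hφ
  have hφ0 : 0 < φ := by positivity
  have hφ6 : φ ≤ Real.pi / 6 := by
    rw [hφ, div_le_div_iff₀ (by positivity) (by norm_num)]
    nlinarith
  have hcos : Real.cos ((k + 1) * φ) = (-1) ^ m := by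
    rw [hφ, mul_div_cancel₀ _ (by positivity), Real.cos_nat_mul_pi]
  rw [← hcos]
  refine thetaSigma_sign_of_cos hke hk hφ0 hφ6 ?_ (by rw [hcos]; norm_num)
  have hsin := Real.sin_gt_sub_cube hφ0
  have hφ2 : φ ^ 2 ≤ 3 / 10 := by nlinarith [Real.pi_lt_d2]
  have hsin' : 19 / 20 * φ ≤ Real.sin φ := by nlinarith
  have hsq : 361 / 100 * φ ^ 2 ≤ (2 * Real.sin φ) ^ 2 := by nlinarith
  have hkφ : 9 * φ ^ 2 * (k + 1) ≥ 9 := by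
    have e : 9 * φ ^ 2 * (k + 1) = Real.pi ^ 2 * (9 * (m : ℝ) ^ 2 / (k + 1)) := by
      rw [hφ]; field_simp
    rw [e]
    have : 1 ≤ 9 * (m : ℝ) ^ 2 / (k + 1) := by
      rw [le_div_iff₀ (by positivity)]; linarith
    nlinarith [Real.pi_gt_three]
  nlinarith [mul_le_mul_of_nonneg_left hsq (by linarith : (0 : ℝ) ≤ k), sq_nonneg φ]

lemma thetaSigma_sign_pi_div_six {k : ℕ} (hke : Even k) (hk : 10 ≤ k) (hk6 : k % 6 = 4) :
    0 < (-1) ^ (k / 6 + 1) * thetaSigma k (-Real.exp (-(Real.pi * Real.sqrt 3))) := by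
  have hpi := Real.pi_pos
  have h3 : Real.sqrt 3 ^ 2 = 3 := Real.sq_sqrt (by norm_num)
  have h3' : 8 / 5 ≤ Real.sqrt 3 := Real.le_sqrt_of_sq_le (by norm_num)
  have hcot : Real.cot (Real.pi / 6) = Real.sqrt 3 := by
    rw [Real.cot_eq_cos_div_sin, Real.cos_pi_div_six, Real.sin_pi_div_six]
    field_simp
  have hkM : (k : ℝ) = 6 * (k / 6 : ℕ) + 4 := by
    exact_mod_cast (show k = 6 * (k / 6) + 4 by omega)
  have hcos : Real.cos ((k + 1) * (Real.pi / 6)) = (-1) ^ (k / 6 + 1) * (Real.sqrt 3 / 2) := by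
    rw [← Real.cos_pi_div_six, ← Real.cos_nat_mul_pi_sub]
    congr 1
    rw [hkM]
    push_cast
    ring
  have h := thetaSigma_sign_of_cos hke hk (α := Real.pi / 6) (by positivity) le_rfl
    (by rw [Real.sin_pi_div_six]; norm_num; omega)
    (by rw [hcos, abs_mul, abs_pow, abs_neg, abs_one, one_pow, one_mul,
          abs_of_pos (by positivity)]; linarith)
  rw [hcot, hcos] at h
  refine pos_of_mul_pos_right (a := Real.sqrt 3 / 2) ?_ (by positivity)
  linarith

lemma I_mul_deriv_Ek_half_add {k : ℕ} (hk : 1 ≤ k) {t : ℝ} (ht : 0 < t) :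
    Complex.I * deriv (Ek k) (1 / 2 + t * Complex.I)
      = ((4 * Real.pi * k / (bernoulli k : ℚ) *
          thetaSigma k (-Real.exp (-(Real.pi * (2 * t)))) : ℝ) : ℂ) := by
  refine I_mul_deriv_Ek hk (by simpa using ht) ?_
  have h : 2 * Real.pi * Complex.I * (1 / 2 + t * Complex.I)
      = ((-(Real.pi * (2 * t)) : ℝ) : ℂ) + Real.pi * Complex.I := by
    push_cast
    linear_combination (2 * Real.pi * t : ℂ) * Complex.I_sq
  rw [h, Complex.exp_add, Complex.exp_pi_mul_I]
  push_cast
  ring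

lemma mul_mul_neg_of_sign {c x y : ℝ} {n : ℕ} (hc : c ≠ 0) (hx : 0 < (-1) ^ n * x)
    (hy : 0 < (-1) ^ (n + 1) * y) : c * x * (c * y) < 0 := by
  have hxy : x * y < 0 := by
    rcases neg_one_pow_eq_or ℝ n with h | h <;> rw [pow_succ, h] at hy <;> rw [h] at hx <;>
      nlinarith
  have hc2 : 0 < c ^ 2 := by positivity
  nlinarith

lemma cot_mul_pi_div_pos {k m : ℕ} (hm : 1 ≤ m) (hmk : 6 * m ≤ k) :
    0 < Real.cot (m * Real.pi / (k + 1)) := by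
  have hpi := Real.pi_pos
  have hm0 : (1 : ℝ) ≤ m := by exact_mod_cast hm
  have hmk' : 6 * (m : ℝ) ≤ k := by exact_mod_cast hmk
  have h0 : 0 < m * Real.pi / ((k : ℝ) + 1) := by positivity
  have h1 : m * Real.pi / ((k : ℝ) + 1) < Real.pi / 2 := by
    rw [div_lt_div_iff₀ (by positivity) (by norm_num)]
    nlinarith
  rw [Real.cot_eq_cos_div_sin]
  exact div_pos (Real.cos_pos_of_mem_Ioo ⟨by linarith, h1⟩)
    (Real.sin_pos_of_pos_of_lt_pi h0 (by linarith))

theorem stmt9 (k : ℕ) (hke : Even k) (hk4 : 4 ≤ k) :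
    let M := k / 6
    let t : ℕ → ℝ := fun m => Real.cot (m * Real.pi / (k + 1)) / 2
    (∀ m : ℕ, 1 ≤ m → m ≤ M - 1 →
      ∃ r s : ℝ, Complex.I * deriv (Ek k) (1 / 2 + (t m) * Complex.I) = (r : ℂ) ∧
        Complex.I * deriv (Ek k) (1 / 2 + (t (m + 1)) * Complex.I) = (s : ℂ) ∧
        r * s < 0) ∧
    (k % 6 = 4 → k ≠ 4 →
      ∃ r s : ℝ, Complex.I * deriv (Ek k) (1 / 2 + (Real.sqrt 3 / 2) * Complex.I) = (r : ℂ) ∧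
        Complex.I * deriv (Ek k) (1 / 2 + (t M) * Complex.I) = (s : ℂ) ∧
        r * s < 0) := by
  intro M t
  have hc : 4 * Real.pi * k / (bernoulli k : ℚ) ≠ 0 := by
    have hb : ((bernoulli k : ℚ) : ℝ) ≠ 0 := by
      exact_mod_cast bernoulli_ne_zero_of_even hke (by omega)
    have hk0 : (k : ℝ) ≠ 0 := by
      have : k ≠ 0 := by omega
      exact_mod_cast this
    have := Real.pi_ne_zero
    positivity
  have ht : ∀ m : ℕ, 1 ≤ m → 6 * m ≤ k → 0 < t m := fun m hm hmk =>
    half_pos (cot_mul_pi_div_pos hm hmk)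
  have hsign : ∀ m : ℕ, 10 ≤ k → 1 ≤ m → 6 * m ≤ k →
      0 < (-1) ^ m * thetaSigma k (-Real.exp (-(Real.pi * (2 * t m)))) := by
    intro m hk hm hmk
    rw [show 2 * t m = Real.cot (m * Real.pi / (k + 1)) from mul_div_cancel₀ _ two_ne_zero]
    exact thetaSigma_sign hke hk hm hmk
  refine ⟨fun m hm hmM => ?_, fun hk6 hk_ne => ?_⟩
  · have hmM' : m ≤ k / 6 - 1 := hmM
    exact ⟨_, _, I_mul_deriv_Ek_half_add (by omega) (ht m hm (by omega)),
      I_mul_deriv_Ek_half_add (by omega) (ht (m + 1) (by omega) (by omega)),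
      mul_mul_neg_of_sign hc (hsign m (by omega) hm (by omega))
        (hsign (m + 1) (by omega) (by omega) (by omega))⟩
  · have h3 := I_mul_deriv_Ek_half_add (k := k) (by omega) (t := Real.sqrt 3 / 2) (by positivity)
    have hs3 := thetaSigma_sign_pi_div_six hke (by omega) hk6
    rw [show Real.sqrt 3 = 2 * (Real.sqrt 3 / 2) by ring] at hs3
    rw [Complex.ofReal_div, Complex.ofReal_ofNat] at h3
    refine ⟨_, _, h3,
      I_mul_deriv_Ek_half_add (by omega) (ht (k / 6) (by omega) (by omega)), ?_⟩
    rw [mul_comm]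
    exact mul_mul_neg_of_sign hc (hsign (k / 6) (by omega) (by omega) (by omega)) hs3
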